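/- Let c ∈ ℝ^m⟨⟨X⟩⟩ and let c^{-1} be its composition inverse, i.e., the unique series with c^{-1} = (−c) ∘̃ c^{-1}. Then for each i = 1, …, m: (c_i^{-1}, x_0 x_0) = −(c_i, x_0 x_0) + Σ_{ℓ=1}^m (c_i, x_ℓ)(c_ℓ, x_0) + Σ_{ℓ=1}^m (c_i, x_ℓ x_0)(c_ℓ, ∅) + Σ_{ℓ=1}^m (c_i, x_0 x_ℓ)(c_ℓ, ∅) − Σ_{ν=1}^m Σ_{ℓ=1}^m (c_i, x_ν)(c_ν, x_ℓ)(c_ℓ, ∅) − Σ_{ν=1}^m Σ_{ℓ=1}^m (c_i, x_ν x_ℓ)(c_ν, ∅)(c_ℓ, ∅). -/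

import Mathlib

open scoped BigOperators

/-- A word over the alphabet `X = {x_0, x_1, …, x_m}`. -/
abbrev Word (m : ℕ) := List (Fin (m+1))

/-- A formal power series in `ℝ⟨⟨X⟩⟩`. -/
abbrev Series (m : ℕ) := Word m → ℝ

/-- A formal power series in `ℝ^l⟨⟨X⟩⟩`. -/
abbrev SeriesVec (l m : ℕ) := Fin l → Series m

/-- The shuffle product on `ℝ⟨⟨X⟩⟩`, defined via the coefficient recursion
`(c ⧢ d, x_i η) = (c^{x_i} ⧢ d, η) + (c ⧢ d^{x_i}, η)` which is the bilinear
extension of `(x_i η) ⧢ (x_j ξ) = x_i (η ⧢ (x_j ξ)) + x_j ((x_i η) ⧢ ξ)`. -/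
def shuffle {m : ℕ} : Series m → Series m → Series m
  | c, d, [] => c [] * d []
  | c, d, i :: η => shuffle (fun w => c (i :: w)) d η + shuffle c (fun w => d (i :: w)) η

/-- `x_ℓ c` : prepend the letter `x_ℓ` to every word of `c`. -/
def prepend {m : ℕ} (ℓ : Fin (m+1)) (c : Series m) : Series m
  | [] => 0
  | j :: w => if j = ℓ then c w else 0

/-- The left quotient `c^{x_ℓ}` : `(c^{x_ℓ}, η) = (c, x_ℓ η)`. -/
def leftQuot {m : ℕ} (ℓ : Fin (m+1)) (c : Series m) : Series m :=
  fun w => c (ℓ :: w)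

/-- The series `1∅`. -/
def oneSeries {m : ℕ} : Series m := fun w => if w = [] then 1 else 0

/-- The constant series `K∅`. -/
def constSeries {m : ℕ} (K : ℝ) : Series m := fun w => if w = [] then K else 0

/-- The component `d_ℓ` of `d ∈ ℝ^m⟨⟨X⟩⟩` indexed by letters, with `d_0 := 0`. -/
def dhat {m : ℕ} (d : Fin m → Series m) (ℓ : Fin (m+1)) : Series m :=
  Fin.cases (motive := fun _ => Series m) 0 d ℓ

/-- The component `d_ℓ` of `d ∈ ℝ^m⟨⟨X⟩⟩` indexed by letters, with `d_0 := 1`. -/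
def dtil {m : ℕ} (d : Fin m → Series m) (ℓ : Fin (m+1)) : Series m :=
  Fin.cases (motive := fun _ => Series m) oneSeries d ℓ

/-- `φ_d(x_ℓ)(e) = x_ℓ e + x_0 (d_ℓ ⧢ e)` with `d_0 := 0`. -/
def phiLetter {m : ℕ} (d : Fin m → Series m) (ℓ : Fin (m+1)) (e : Series m) : Series m :=
  prepend ℓ e + prepend 0 (shuffle (dhat d ℓ) e)

/-- `φ_d(η)` for a word `η`, with `φ_d(∅) = id` and `φ_d(x_ℓ η) = φ_d(x_ℓ) ∘ φ_d(η)`. -/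
def phi {m : ℕ} (d : Fin m → Series m) : Word m → Series m → Series m
  | [], e => e
  | ℓ :: η, e => phiLetter d ℓ (phi d η e)

/-- The modified composition product `c ∘̃ d = Σ_{η ∈ X*} (c, η) φ_d(η)(1)`.
Since `φ_d(η)(1)` has no words of length `< |η|`, the coefficient of a word `ν`
is given by the (finite) sum over all words `η` with `|η| ≤ |ν|`. -/
def modComp {m : ℕ} (c : Series m) (d : Fin m → Series m) : Series m :=
  fun ν => ∑ k ∈ Finset.range (ν.length + 1), ∑ η : Fin k → Fin (m+1),
    c (List.ofFn η) * phi d (List.ofFn η) oneSeries ν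

/-- The modified composition product on `ℝ^l⟨⟨X⟩⟩`, componentwise. -/
def modCompVec {l m : ℕ} (c : SeriesVec l m) (d : SeriesVec m m) : SeriesVec l m :=
  fun i => modComp (c i) d

/-- `ψ_d(x_ℓ)(e) = x_0 (d_ℓ ⧢ e)` with `d_0 := 1`. -/
def psiLetter {m : ℕ} (d : Fin m → Series m) (ℓ : Fin (m+1)) (e : Series m) : Series m :=
  prepend 0 (shuffle (dtil d ℓ) e)

/-- `ψ_d(η)` for a word `η`, with `ψ_d(∅) = id` and `ψ_d(x_ℓ η) = ψ_d(x_ℓ) ∘ ψ_d(η)`. -/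
def psi {m : ℕ} (d : Fin m → Series m) : Word m → Series m → Series m
  | [], e => e
  | ℓ :: η, e => psiLetter d ℓ (psi d η e)

/-- The composition product `c ∘ d = Σ_{η ∈ X*} (c, η) ψ_d(η)(1)`. -/
def comp {m : ℕ} (c : Series m) (d : Fin m → Series m) : Series m :=
  fun ν => ∑ k ∈ Finset.range (ν.length + 1), ∑ η : Fin k → Fin (m+1),
    c (List.ofFn η) * psi d (List.ofFn η) oneSeries ν

/-- The composition product on `ℝ^l⟨⟨X⟩⟩`, componentwise. -/
def compVec {l m : ℕ} (c : SeriesVec l m) (d : SeriesVec m m) : SeriesVec l m :=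
  fun i => comp (c i) d

/-- The group product `c ⊚ d := d + c ∘̃ d` of the output feedback group,
so that `(δ + c) ∘ (δ + d) = δ + c ⊚ d`. -/
def oplus {m : ℕ} (c d : SeriesVec m m) : SeriesVec m m :=
  d + modCompVec c d

/-- A sum over the words of length one is a sum over letters. -/
theorem sum_words_one {m : ℕ} (f : Word m → ℝ) :
    ∑ η : Fin 1 → Fin (m+1), f (List.ofFn η) = ∑ a, f [a] :=
  Fintype.sum_equiv (Equiv.funUnique (Fin 1) (Fin (m+1))) _ _ fun η => by simp

/-- A sum over the words of length two is a double sum over letters. -/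
theorem sum_words_two {m : ℕ} (f : Word m → ℝ) :
    ∑ η : Fin 2 → Fin (m+1), f (List.ofFn η) = ∑ a, ∑ b, f [a, b] := by
  rw [← Fintype.sum_prod_type' (f := fun a b => f [a, b])]
  exact Fintype.sum_equiv (finTwoArrowEquiv (Fin (m+1))) _ _ fun η => by simp

theorem modComp_nil {m : ℕ} (c : Series m) (d : Fin m → Series m) :
    modComp c d [] = c [] := by
  simp [modComp, phi, oneSeries]

theorem modComp_zero {m : ℕ} (c : Series m) (d : Fin m → Series m) :
    modComp c d [0] = c [0] + ∑ l : Fin m, c [l.succ] * d l [] := by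
  simp only [modComp, List.length_cons, List.length_nil, Finset.sum_range_succ,
    Finset.sum_range_zero, sum_words_one fun w => c w * phi d w oneSeries [0]]
  simp [phi, phiLetter, prepend, shuffle, oneSeries, dhat, Fin.sum_univ_succ,
    (Fin.succ_ne_zero _).symm]

theorem modComp_zero_zero {m : ℕ} (c : Series m) (d : Fin m → Series m) :
    modComp c d [0, 0] = c [0, 0] + (∑ l : Fin m, c [l.succ] * d l [0]) +
      (∑ l : Fin m, c [l.succ, 0] * d l []) + (∑ l : Fin m, c [0, l.succ] * d l []) +
      ∑ ν : Fin m, ∑ l : Fin m, c [ν.succ, l.succ] * d ν [] * d l [] := by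
  simp only [modComp, List.length_cons, List.length_nil, Finset.sum_range_succ,
    Finset.sum_range_zero, sum_words_one fun w => c w * phi d w oneSeries [0, 0],
    sum_words_two fun w => c w * phi d w oneSeries [0, 0]]
  simp [phi, phiLetter, prepend, shuffle, oneSeries, dhat, Fin.sum_univ_succ,
    (Fin.succ_ne_zero _).symm, Finset.sum_add_distrib, mul_assoc]
  ring

/-- antipode evaluation in degree 5: for the composition inverse
`c⁻¹` of `c`,
`(c_i⁻¹, x_0 x_0) = −(c_i, x_0 x_0) + Σ_ℓ (c_i, x_ℓ)(c_ℓ, x_0)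
 + Σ_ℓ (c_i, x_ℓ x_0)(c_ℓ, ∅) + Σ_ℓ (c_i, x_0 x_ℓ)(c_ℓ, ∅)
 − Σ_ν Σ_ℓ (c_i, x_ν)(c_ν, x_ℓ)(c_ℓ, ∅) − Σ_ν Σ_ℓ (c_i, x_ν x_ℓ)(c_ν, ∅)(c_ℓ, ∅)`. -/
theorem antipode_degree_five (m : ℕ) (c cinv : SeriesVec m m)
    (hinv : cinv = modCompVec (-c) cinv) :
    ∀ i : Fin m,
      cinv i [0, 0] =
        -(c i [0, 0]) + (∑ l : Fin m, c i [l.succ] * c l [0]) +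
          (∑ l : Fin m, c i [l.succ, 0] * c l []) +
          (∑ l : Fin m, c i [0, l.succ] * c l []) -
          (∑ ν : Fin m, ∑ l : Fin m, c i [ν.succ] * c ν [l.succ] * c l []) -
          ∑ ν : Fin m, ∑ l : Fin m, c i [ν.succ, l.succ] * c ν [] * c l [] := by
  intro i
  have h_nil (l : Fin m) : cinv l [] = -c l [] := by
    rw [hinv]; exact modComp_nil _ _
  have h_zero (l : Fin m) : cinv l [0] = -c l [0] + ∑ k : Fin m, c l [k.succ] * c k [] := by
    have h : cinv l [0] = modComp ((-c) l) cinv [0] := congrFun (congrFun hinv l) [0]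
    rw [h, modComp_zero]
    simp [h_nil]
  have h : cinv i [0, 0] = modComp ((-c) i) cinv [0, 0] := congrFun (congrFun hinv i) [0, 0]
  rw [h, modComp_zero_zero]
  simp only [h_nil, h_zero, Pi.neg_apply, mul_add, Finset.mul_sum, Finset.sum_add_distrib,
    neg_mul, mul_neg, neg_neg, Finset.sum_neg_distrib, mul_assoc]
  ring
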